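/- Fix s > −1 and for any integrable real random variable X define ∇̄_s(X) = (1+s) Σ_{n≥0} ((−s)_n/(n+1)!) Δ̄_n(X), where Δ̄_0(X) = −∫_ℝ F̄_X log F̄_X dx and Δ̄_n(X) = (1/n) ∫_ℝ F̄_X(x)(1 − F̄_X(x)^n) dx for n ≥ 1, and set ν_s^∇(X) = E[X] + ∇̄_s(X). Then ν_s^∇ is a coherent risk measure on the set of integrable X with Δ̄_0(X) < ∞: (i) if F̄_X ≤ F̄_Y pointwise then ν_s^∇(X) ≤ ν_s^∇(Y); (ii) ν_s^∇(aX) = a·ν_s^∇(X) for every a > 0; (iii) ν_s^∇(X + b) = ν_s^∇(X) + b for every b ∈ ℝ; (iv) ν_s^∇(X + Y) ≤ ν_s^∇(X) + ν_s^∇(Y) for any two (not necessarily independent) random variables X, Y on the same probability space with Δ̄_0(X), Δ̄_0(Y), Δ̄_0(X+Y) finite. -/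

import Mathlib

open MeasureTheory Set

/-- The tail distribution function `F̄_X(x) = P(X > x)`. -/
noncomputable def tailCDF {Ω : Type*} [MeasureSpace Ω] (X : Ω → ℝ) (x : ℝ) : ℝ :=
  ((volume : Measure Ω) {ω | x < X ω}).toReal

/-- The cumulative residual Tsallis entropy of integer order:
`Δ̄_0(X) = −∫ F̄ log F̄` and `Δ̄_n(X) = (1/n) ∫ F̄ (1 − F̄^n)` for `n ≥ 1`. -/
noncomputable def cumResNat {Ω : Type*} [MeasureSpace Ω] (n : ℕ) (X : Ω → ℝ) : ℝ :=
  if n = 0 then -∫ x : ℝ, tailCDF X x * Real.log (tailCDF X x)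
  else (1 / (n : ℝ)) * ∫ x : ℝ, tailCDF X x * (1 - tailCDF X x ^ n)

/-- The dual cumulative residual Tsallis entropy
`∇̄_s(X) = (1+s) Σ_{n≥0} ((−s)_n/(n+1)!) Δ̄_n(X)`. -/
noncomputable def nablaBar {Ω : Type*} [MeasureSpace Ω] (s : ℝ) (X : Ω → ℝ) : ℝ :=
  (1 + s) * ∑' n : ℕ,
    ((ascPochhammer ℝ n).eval (-s) / (Nat.factorial (n + 1) : ℝ)) * cumResNat n X

/-- The risk measure `ν_s^∇(X) = E[X] + ∇̄_s(X)`. -/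
noncomputable def nuNabla {Ω : Type*} [MeasureSpace Ω] (s : ℝ) (X : Ω → ℝ) : ℝ :=
  (∫ ω, X ω) + nablaBar s X


noncomputable def acf (s : ℝ) (n : ℕ) : ℝ := (ascPochhammer ℝ n).eval (-s) / (Nat.factorial n : ℝ)

lemma acf_zero (s : ℝ) : acf s 0 = 1 := by simp [acf]

lemma acf_succ (s : ℝ) (n : ℕ) : acf s (n+1) = acf s n * ((n - s) / (n + 1)) := by
  have h1 : (n.factorial : ℝ) ≠ 0 := by positivity
  have h2 : (n : ℝ) + 1 ≠ 0 := by positivity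
  unfold acf
  rw [ascPochhammer_succ_eval, Nat.factorial_succ]
  push_cast
  field_simp
  ring

lemma coef_eq (s : ℝ) (n : ℕ) :
    (ascPochhammer ℝ n).eval (-s) / (Nat.factorial (n + 1) : ℝ) = acf s n / (n + 1) := by
  unfold acf
  rw [Nat.factorial_succ]
  push_cast
  rw [div_div, mul_comm]

lemma choose_eq_acf (s : ℝ) (n : ℕ) : Ring.choose s n = (-1) ^ n * acf s n := by
  unfold acf
  rw [Ring.choose_eq_smul, smul_eq_mul]
  have h := Polynomial.descPochhammer_smeval_eq_ascPochhammer s n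
  induction n with
  | zero => simp
  | succ k ih => 
    rw [ascPochhammer_succ_eval, descPochhammer_succ_right, Nat.factorial_succ]
    have h1 : (k.factorial : ℝ) ≠ 0 := by positivity
    have h2 : (k : ℝ) + 1 ≠ 0 := by positivity
    have ih' := ih (Polynomial.descPochhammer_smeval_eq_ascPochhammer s k)
    rw [Polynomial.smeval_mul, Polynomial.smeval_sub, Polynomial.smeval_X, Polynomial.smeval_natCast]
    simp only [pow_one, pow_zero, nsmul_eq_mul, mul_one]
    have e : Polynomial.smeval (descPochhammer ℤ k) s
        = (-1) ^ k * Polynomial.eval (-s) (ascPochhammer ℝ k) := by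
      field_simp at ih'
      linarith
    rw [e]
    push_cast
    field_simp
    ring

lemma acf_hasSum (s t : ℝ) (h0 : 0 < t) (h1 : t < 1) :
    HasSum (fun n => acf s n * t ^ n) ((1 - t) ^ s) := by
  have h := (Real.one_add_rpow_hasFPowerSeriesOnBall_zero (a := s)).hasSum
    (y := -t) (by
      simp only [Metric.mem_eball, edist_zero_right, enorm_neg]
      rw [Real.enorm_eq_ofReal h0.le]
      exact ENNReal.ofReal_lt_one.2 h1)
  simp only [zero_add, binomialSeries_apply, List.ofFn_const, List.prod_replicate, smul_eq_mul, choose_eq_acf] at h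
  rw [← sub_eq_add_neg] at h
  suffices e : (fun n => acf s n * t ^ n) = fun n => (-1) ^ n * acf s n * (-t) ^ n by
    rw [e]; exact h
  funext n
  rw [neg_pow t n]
  have : ((-1:ℝ)^n) * (-1)^n = 1 := by rw [← mul_pow]; norm_num
  linear_combination (-acf s n * t ^ n) * this

lemma acf_summable (s : ℝ) (hs : -1 < s) : Summable (fun n : ℕ => |acf s n| / (n + 1)) := by
  obtain ⟨N, hN⟩ := exists_nat_gt s
  rw [← summable_nat_add_iff N]
  have key : ∀ k : ℕ, |acf s (k + N)| / (((k + N : ℕ) : ℝ) + 1)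
      = (|acf s (k + N)| - |acf s (k + 1 + N)|) / (1 + s) := by
    intro k
    have e : k + 1 + N = (k + N) + 1 := by ring
    have h2 : (((k + N : ℕ) : ℝ) + 1) ≠ 0 := by positivity
    have h3 : 1 + s ≠ 0 := by linarith
    have h4 : 0 ≤ ((((k + N : ℕ) : ℝ)) - s) / ((((k + N : ℕ) : ℝ)) + 1) := by
      apply div_nonneg
      · push_cast
        have : (0:ℝ) ≤ k := by positivity
        linarith
      · positivity
    rw [e, acf_succ, abs_mul, abs_of_nonneg h4]
    field_simp
    ring
  apply summable_of_sum_range_le (c := |acf s N| / (1 + s))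
  · intro n; positivity
  · intro n
    rw [Finset.sum_congr rfl (fun k _ => key k), ← Finset.sum_div, 
      Finset.sum_range_sub' (fun k => |acf s (k + N)|)]
    have : 0 < 1 + s := by linarith
    gcongr
    simp

lemma swap_general (s : ℝ) (hs : -1 < s) (H : ℝ → ℝ) (hH : IntegrableOn H (Ioo 0 1))
    (K : ℝ) (hK : ∀ n : ℕ, (n + 1) * ∫ t in Ioo (0:ℝ) 1, t ^ n * |H t| ≤ K) :
    IntegrableOn (fun t => (1 - t) ^ s * H t) (Ioo 0 1) ∧
    HasSum (fun n : ℕ => acf s n / (n + 1) * ((n + 1) * ∫ t in Ioo (0:ℝ) 1, t ^ n * H t))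
      (∫ t in Ioo (0:ℝ) 1, (1 - t) ^ s * H t) := by
  set F : ℕ → ℝ → ℝ := fun n t => acf s n * (t ^ n * H t) with hF
  have hFi : ∀ n, Integrable (F n) (volume.restrict (Ioo 0 1)) := by
    intro n
    apply Integrable.const_mul
    refine Integrable.bdd_mul (c := 1) hH (by fun_prop) ?_
    filter_upwards [ae_restrict_mem measurableSet_Ioo] with t ht
    rw [Real.norm_eq_abs, abs_of_nonneg (by have := ht.1; positivity)]
    exact pow_le_one₀ ht.1.le ht.2.le
  have hnorm : ∀ n, ∫ t in Ioo (0:ℝ) 1, ‖F n t‖ = |acf s n| * ∫ t in Ioo (0:ℝ) 1, t ^ n * |H t| := by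
    intro n
    rw [← integral_const_mul]
    apply setIntegral_congr_fun measurableSet_Ioo
    intro t ht
    simp only [hF, Real.norm_eq_abs, abs_mul, abs_pow, abs_of_pos ht.1]
  have hsum : Summable (fun n => ∫ t in Ioo (0:ℝ) 1, ‖F n t‖) := by
    refine Summable.of_nonneg_of_le (fun n => integral_nonneg fun t => norm_nonneg _) ?_
      ((acf_summable s hs).mul_right K)
    intro n
    rw [hnorm]
    have h2 : ((n:ℝ) + 1) ≠ 0 := by positivity
    calc _ = |acf s n| / (n + 1) * ((n + 1) * ∫ t in Ioo (0:ℝ) 1, t ^ n * |H t|) := by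
            field_simp
      _ ≤ _ := by gcongr; exact hK n
  have hts : ∀ t ∈ Ioo (0:ℝ) 1, HasSum (fun n => F n t) ((1 - t) ^ s * H t) := by
    intro t ht
    have := (acf_hasSum s t ht.1 ht.2).mul_right (H t)
    simpa only [hF, mul_assoc] using this
  constructor
  · constructor
    · apply AEStronglyMeasurable.mul _ hH.1
      exact Measurable.aestronglyMeasurable (by fun_prop)
    · have hb : ∫⁻ t in Ioo (0:ℝ) 1, ‖(1 - t) ^ s * H t‖ₑ ≤ ∑' n, ∫⁻ t in Ioo (0:ℝ) 1, ‖F n t‖ₑ := by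
        rw [← lintegral_tsum (fun n => (hFi n).1.enorm)]
        apply setLIntegral_mono_ae' measurableSet_Ioo
        filter_upwards with t ht
        rw [← (hts t ht).tsum_eq]
        exact enorm_tsum_le_tsum_enorm
      refine lt_of_le_of_lt hb ?_
      have e : ∀ n, ∫⁻ t in Ioo (0:ℝ) 1, ‖F n t‖ₑ = ENNReal.ofReal (∫ t in Ioo (0:ℝ) 1, ‖F n t‖) := 
        fun n => (ofReal_integral_norm_eq_lintegral_enorm (hFi n)).symm
      simp_rw [e]
      exact hsum.tsum_ofReal_lt_top
  · have h := hasSum_integral_of_summable_integral_norm hFi hsum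
    have e2 : ∫ t in Ioo (0:ℝ) 1, ∑' n, F n t = ∫ t in Ioo (0:ℝ) 1, (1 - t) ^ s * H t :=
      setIntegral_congr_fun measurableSet_Ioo (fun t ht => (hts t ht).tsum_eq)
    rw [e2] at h
    suffices e : (fun n : ℕ => acf s n / (n + 1) * ((n + 1) * ∫ t in Ioo (0:ℝ) 1, t ^ n * H t))
        = fun n => ∫ t in Ioo (0:ℝ) 1, F n t by
      rw [e]; exact h
    funext n
    have h2 : ((n:ℝ) + 1) ≠ 0 := by positivity
    simp only [hF]
    rw [integral_const_mul]
    field_simp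

lemma pow_int (n : ℕ) : ((n:ℝ) + 1) * ∫ t in Ioo (0:ℝ) 1, t ^ n = 1 := by
  rw [← integral_Ioc_eq_integral_Ioo, ← intervalIntegral.integral_of_le zero_le_one, integral_pow]
  have h2 : ((n:ℝ) + 1) ≠ 0 := by positivity
  field_simp
  simp

lemma one_sub_rpow_int (s : ℝ) (hs : -1 < s) : ∫ t in Ioo (0:ℝ) 1, (1 - t) ^ s = 1 / (1 + s) := by
  rw [← integral_Ioc_eq_integral_Ioo, ← intervalIntegral.integral_of_le zero_le_one,
    intervalIntegral.integral_comp_sub_left (fun x => x ^ s)]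
  rw [integral_rpow (Or.inl (by simpa using hs))]
  have : s + 1 ≠ 0 := by linarith
  simp [Real.zero_rpow this, add_comm]

noncomputable def gg (t u : ℝ) : ℝ := min (u / t) 1 - u

lemma gg_nonneg {t u : ℝ} (ht : 0 < t) (ht1 : t < 1) (hu : 0 ≤ u) (hu1 : u ≤ 1) : 0 ≤ gg t u := by
  unfold gg
  have : u ≤ u / t := by rw [le_div_iff₀ ht]; nlinarith
  have := le_min this hu1
  linarith

lemma gg_le_one_sub (t u : ℝ) : gg t u ≤ 1 - u := by
  unfold gg
  have := min_le_right (u / t) 1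
  linarith

lemma gg_le_div (t u : ℝ) : gg t u ≤ u / t - u := by
  unfold gg
  have := min_le_left (u / t) 1
  linarith

lemma gg_measurable : Measurable (fun p : ℝ × ℝ => gg p.1 p.2) := by
  unfold gg; fun_prop

lemma gg_integrableOn {u : ℝ} (hu : 0 ≤ u) (hu1 : u ≤ 1) :
    IntegrableOn (fun t => gg t u) (Ioo 0 1) := by
  refine Measure.integrableOn_of_bounded (M := 1) (by simp) ?_ ?_
  · exact (gg_measurable.comp (measurable_id.prodMk measurable_const)).aestronglyMeasurable
  · filter_upwards [ae_restrict_mem measurableSet_Ioo] with t ht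
    rw [Real.norm_eq_abs, abs_of_nonneg (gg_nonneg ht.1 ht.2 hu hu1)]
    linarith [gg_le_one_sub t u]

lemma pow_mul_integrableOn {H : ℝ → ℝ} (hH : IntegrableOn H (Ioo 0 1)) (n : ℕ) :
    IntegrableOn (fun t => t ^ n * H t) (Ioo 0 1) := by
  refine Integrable.bdd_mul (c := 1) hH (by fun_prop) ?_
  filter_upwards [ae_restrict_mem measurableSet_Ioo] with t ht
  rw [Real.norm_eq_abs, abs_of_nonneg (by have := ht.1; positivity)]
  exact pow_le_one₀ ht.1.le ht.2.le

lemma gg_int_aux {u : ℝ} (hu : 0 < u) (hu1 : u < 1) (n : ℕ) :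
    ((n:ℝ) + 1) * ∫ t in Ioo (0:ℝ) 1, t ^ n * gg t u =
      ((n:ℝ) + 1) * ((1 - u) * ∫ t in (0:ℝ)..u, t ^ n)
        + ((n:ℝ) + 1) * ((u * ∫ t in u..1, t ^ n / t) - u * ∫ t in u..1, t ^ n) := by
  rw [← mul_add]
  congr 1
  have hI : IntervalIntegrable (fun t => t ^ n * gg t u) volume 0 1 := by
    rw [intervalIntegrable_iff_integrableOn_Ioo_of_le zero_le_one]
    exact pow_mul_integrableOn (gg_integrableOn hu.le hu1.le) n
  rw [← integral_Ioc_eq_integral_Ioo, ← intervalIntegral.integral_of_le zero_le_one,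
    ← intervalIntegral.integral_add_adjacent_intervals (b := u)
      (hI.mono_set (by rw [uIcc_of_le hu.le, uIcc_of_le zero_le_one]; exact Icc_subset_Icc le_rfl hu1.le))
      (hI.mono_set (by rw [uIcc_of_le hu1.le, uIcc_of_le zero_le_one]; exact Icc_subset_Icc hu.le le_rfl))]
  congr 1
  · rw [← intervalIntegral.integral_const_mul, intervalIntegral.integral_of_le hu.le,
      intervalIntegral.integral_of_le hu.le]
    apply setIntegral_congr_fun measurableSet_Ioc
    intro t ht
    simp only [gg]
    rw [min_eq_right (by rw [le_div_iff₀ ht.1]; linarith [ht.2])]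
    ring
  · have hc : ContinuousOn (fun t : ℝ => t ^ n / t) (uIcc u 1) := by
      apply ContinuousOn.div (by fun_prop) (by fun_prop)
      intro t ht
      rw [uIcc_of_le hu1.le] at ht
      linarith [ht.1]
    rw [← intervalIntegral.integral_const_mul, ← intervalIntegral.integral_const_mul,
      ← intervalIntegral.integral_sub]
    · rw [intervalIntegral.integral_of_le hu1.le, intervalIntegral.integral_of_le hu1.le]
      apply setIntegral_congr_fun measurableSet_Ioc
      intro t ht
      simp only [gg]
      have ht0 : 0 < t := by linarith [ht.1]
      rw [min_eq_left (by rw [div_le_iff₀ ht0]; linarith [ht.1])]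
      ring
    · exact (hc.intervalIntegrable).const_mul _
    · exact (Continuous.intervalIntegrable (by fun_prop) _ _)

noncomputable def dlt (n : ℕ) (u : ℝ) : ℝ :=
  if n = 0 then -(u * Real.log u) else (1 / (n : ℝ)) * (u * (1 - u ^ n))

lemma gg_int {u : ℝ} (hu : 0 ≤ u) (hu1 : u ≤ 1) (n : ℕ) :
    ((n:ℝ) + 1) * ∫ t in Ioo (0:ℝ) 1, t ^ n * gg t u = dlt n u := by
  rcases hu.eq_or_lt with rfl | hu0
  · simp [gg, dlt]
  rcases hu1.eq_or_lt with rfl | hu1'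
  · have : ∫ t in Ioo (0:ℝ) 1, t ^ n * gg t 1 = ∫ t in Ioo (0:ℝ) 1, 0 := by
      apply setIntegral_congr_fun measurableSet_Ioo
      intro t ht
      simp only [gg]
      rw [min_eq_right (by rw [le_div_iff₀ ht.1]; linarith [ht.2])]
      simp
    rw [this]
    simp [dlt]
  rw [gg_int_aux hu0 hu1', dlt]
  have h2 : ((n:ℝ) + 1) ≠ 0 := by positivity
  rcases n with _ | m
  · have h3 : ∫ t in u..1, 1 / t = Real.log (1 / u) := integral_one_div_of_pos hu0 one_pos
    simp only [pow_zero, h3]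
    simp
    ring
  · have h3 : ∫ t in u..1, t ^ (m + 1) / t = ∫ t in u..1, t ^ m := by
      rw [intervalIntegral.integral_of_le hu1'.le, intervalIntegral.integral_of_le hu1'.le]
      apply setIntegral_congr_fun measurableSet_Ioc
      intro t ht
      have ht0 : t ≠ 0 := by linarith [ht.1]
      simp only
      field_simp
      ring
    rw [h3]
    simp only [integral_pow]
    have h4 : (m:ℝ) + 1 ≠ 0 := by positivity
    have h5 : (m:ℝ) + 1 + 1 ≠ 0 := by positivity
    simp only [Nat.add_eq_zero_iff, one_ne_zero, and_false, if_false]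
    push_cast
    field_simp
    simp
    ring

lemma dlt_le {u : ℝ} (hu : 0 ≤ u) (hu1 : u ≤ 1) (n : ℕ) : dlt n u ≤ dlt 0 u := by
  rcases n with _ | m
  · exact le_rfl
  rcases hu.eq_or_lt with rfl | hu0
  · simp [dlt]
  have h4 : (0:ℝ) < (m:ℝ) + 1 := by positivity
  simp only [dlt, Nat.add_eq_zero_iff, one_ne_zero, and_false, if_false, if_true]
  have h := Real.log_le_sub_one_of_pos (pow_pos hu0 (m+1))
  rw [Real.log_pow] at h
  push_cast at h ⊢
  rw [one_div, inv_mul_le_iff₀ h4]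
  nlinarith

section tails
variable {Ω : Type*} [MeasureSpace Ω] [IsProbabilityMeasure (volume : Measure Ω)]

lemma tail_nonneg {Ω : Type*} [MeasureSpace Ω] (X : Ω → ℝ) (x : ℝ) : 0 ≤ tailCDF X x := ENNReal.toReal_nonneg

lemma tail_le_one (X : Ω → ℝ) (x : ℝ) : tailCDF X x ≤ 1 := by
  have : (volume : Measure Ω).real {ω | x < X ω} ≤ 1 := measureReal_le_one
  exact this

lemma tail_antitone (X : Ω → ℝ) : Antitone (tailCDF X) := by
  intro x y hxy
  have : (volume : Measure Ω).real {ω | y < X ω} ≤ (volume : Measure Ω).real {ω | x < X ω} :=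
    measureReal_mono (fun ω (h : y < X ω) => lt_of_le_of_lt hxy h)
  exact this

lemma tail_measurable (X : Ω → ℝ) : Measurable (tailCDF X) := (tail_antitone X).measurable

lemma one_sub_tail {X : Ω → ℝ} (hX : Measurable X) (x : ℝ) :
    1 - tailCDF X x = (volume : Measure Ω).real {ω | X ω ≤ x} := by
  have h : MeasurableSet {ω | x < X ω} := measurableSet_lt measurable_const hX
  have h2 := probReal_compl_eq_one_sub (μ := (volume : Measure Ω)) h
  have e : {ω | x < X ω}ᶜ = {ω | X ω ≤ x} := by ext; simp
  rw [e] at h2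
  rw [h2]; rfl

lemma tail_eq_cdf {X : Ω → ℝ} (hX : Measurable X) (x : ℝ) :
    tailCDF X x = 1 - ProbabilityTheory.cdf ((volume : Measure Ω).map X) x := by
  have := Measure.isProbabilityMeasure_map (μ := (volume : Measure Ω)) hX.aemeasurable
  rw [ProbabilityTheory.cdf_eq_real, map_measureReal_apply hX measurableSet_Iic]
  have := one_sub_tail hX x
  have e : X ⁻¹' Iic x = {ω | X ω ≤ x} := rfl
  rw [e]; linarith

lemma quantile {X : Ω → ℝ} (hX : Measurable X) {t : ℝ} (ht : 0 < t) (ht1 : t < 1) :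
    ∃ c, (∀ x, c < x → tailCDF X x ≤ t) ∧ (∀ x, x < c → t ≤ tailCDF X x) := by
  set μ := (volume : Measure Ω).map X
  obtain ⟨x₀, hx₀⟩ := ((ProbabilityTheory.tendsto_cdf_atBot μ).eventually_lt_const
    (show (0:ℝ) < 1 - t by linarith)).exists
  obtain ⟨x₁, hx₁⟩ := ((ProbabilityTheory.tendsto_cdf_atTop μ).eventually_const_lt
    (show (1 - t : ℝ) < 1 by linarith)).exists
  set S := {x | t ≤ tailCDF X x} with hS
  have hne : S.Nonempty := ⟨x₀, by
    change t ≤ tailCDF X x₀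
    rw [tail_eq_cdf hX]; linarith⟩
  have hbd : BddAbove S := ⟨x₁, by
    intro x hx
    by_contra hlt
    push Not at hlt
    have h1 := tail_antitone X hlt.le
    have h2 : t ≤ tailCDF X x := hx
    rw [tail_eq_cdf hX x₁] at h1
    linarith⟩
  refine ⟨sSup S, ?_, ?_⟩
  · intro x hx
    by_contra hlt
    push Not at hlt
    exact absurd (le_csSup hbd (show x ∈ S from hlt.le)) (not_le.2 hx)
  · intro x hx
    obtain ⟨y, hy, hxy⟩ := exists_lt_of_lt_csSup hne hx
    exact le_trans hy (tail_antitone X hxy.le)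

lemma pos_part {X : Ω → ℝ} (hX : Integrable X) (c : ℝ) :
    IntegrableOn (tailCDF X) (Ioi c) ∧ ∫ ω, max (X ω - c) 0 = ∫ x in Ioi c, tailCDF X x := by
  have hf : Integrable (fun ω => max (X ω - c) 0) := (hX.sub (integrable_const c)).pos_part
  have hnn : 0 ≤ᵐ[volume] (fun ω => max (X ω - c) 0) := by
    filter_upwards with ω using le_max_right _ _
  have hset : ∀ t ∈ Ioi (0:ℝ), {ω | t < max (X ω - c) 0} = {ω | c + t < X ω} := by
    intro t ht
    ext ω
    have : ¬ t < 0 := not_lt.2 (le_of_lt ht)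
    simp only [mem_ofPred_eq, lt_max_iff, this, or_false]
    constructor <;> intro h <;> linarith
  have mp := measurePreserving_add_left (volume : Measure ℝ) c
  have me := measurableEmbedding_addLeft c
  have pre : (fun t : ℝ => c + t) ⁻¹' Ioi c = Ioi 0 := by ext; simp
  constructor
  · have h := lintegral_eq_lintegral_meas_lt volume hnn hf.aemeasurable
    have hfin := Integrable.lintegral_lt_top hf
    rw [h] at hfin
    rw [← mp.integrableOn_comp_preimage me, pre]
    have h2 : Integrable (fun t => ((volume : Measure Ω) {ω | t < max (X ω - c) 0}).toReal)
        (volume.restrict (Ioi 0)) := by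
      refine integrable_toReal_of_lintegral_ne_top ?_ hfin.ne
      apply Measurable.aemeasurable
      apply Antitone.measurable
      intro x y hxy
      exact measure_mono (fun ω (h : y < _) => lt_of_le_of_lt hxy h)
    refine IntegrableOn.congr_fun h2 ?_ measurableSet_Ioi
    intro t ht
    simp only [hset t ht]
    rfl
  · rw [Integrable.integral_eq_integral_meas_lt hf hnn, ← mp.setIntegral_preimage_emb me (tailCDF X), pre]
    apply setIntegral_congr_fun measurableSet_Ioi
    intro t ht
    simp only [hset t ht]
    rfl

lemma neg_part {X : Ω → ℝ} (hXm : Measurable X) (hX : Integrable X) (c : ℝ) :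
    IntegrableOn (fun x => 1 - tailCDF X x) (Iic c) ∧
      ∫ ω, max (c - X ω) 0 = ∫ x in Iic c, (1 - tailCDF X x) := by
  have hf : Integrable (fun ω => max (c - X ω) 0) := ((integrable_const c).sub hX).pos_part
  have hnn : 0 ≤ᵐ[volume] (fun ω => max (c - X ω) 0) := by
    filter_upwards with ω using le_max_right _ _
  have hset : ∀ t ∈ Ioi (0:ℝ), {ω | t ≤ max (c - X ω) 0} = {ω | X ω ≤ c - t} := by
    intro t ht
    ext ω
    have : ¬ t ≤ 0 := not_le.2 ht
    simp only [mem_ofPred_eq, le_max_iff, this, or_false]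
    constructor <;> intro h <;> linarith
  have mp := Measure.measurePreserving_sub_left (volume : Measure ℝ) c
  have me : MeasurableEmbedding (fun t : ℝ => c - t) := (MeasurableEquiv.subLeft c).measurableEmbedding
  have pre : (fun t : ℝ => c - t) ⁻¹' Iio c = Ioi 0 := by ext; simp
  rw [integral_Iic_eq_integral_Iio, integrableOn_Iic_iff_integrableOn_Iio]
  constructor
  · have h := lintegral_eq_lintegral_meas_le volume hnn hf.aemeasurable
    have hfin := Integrable.lintegral_lt_top hf
    rw [h] at hfin
    rw [← mp.integrableOn_comp_preimage me, pre]
    have h2 : Integrable (fun t => ((volume : Measure Ω) {ω | t ≤ max (c - X ω) 0}).toReal)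
        (volume.restrict (Ioi 0)) := by
      refine integrable_toReal_of_lintegral_ne_top ?_ hfin.ne
      apply Measurable.aemeasurable
      apply Antitone.measurable
      intro x y hxy
      exact measure_mono (fun ω (h : y ≤ _) => le_trans hxy h)
    refine IntegrableOn.congr_fun h2 ?_ measurableSet_Ioi
    intro t ht
    simp only [hset t ht, Function.comp]
    rw [one_sub_tail hXm]
    rfl
  · rw [Integrable.integral_eq_integral_meas_le hf hnn,
      ← mp.setIntegral_preimage_emb me (fun x => 1 - tailCDF X x), pre]
    apply setIntegral_congr_fun measurableSet_Ioi
    intro t ht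
    simp only [hset t ht]
    rw [one_sub_tail hXm]

noncomputable def cv (X : Ω → ℝ) (t : ℝ) : ℝ := (∫ ω, X ω) + ∫ x, gg t (tailCDF X x)

lemma mean_decomp {X : Ω → ℝ} (hXm : Measurable X) (hX : Integrable X) (c : ℝ) :
    ∫ ω, X ω = c + (∫ x in Ioi c, tailCDF X x) - ∫ x in Iic c, (1 - tailCDF X x) := by
  rw [← (pos_part hX c).2, ← (neg_part hXm hX c).2]
  have h1 : Integrable (fun ω => max (X ω - c) 0) := (hX.sub (integrable_const c)).pos_part
  have h2 : Integrable (fun ω => max (c - X ω) 0) := ((integrable_const c).sub hX).pos_part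
  have e : ∀ ω, X ω = (c + max (X ω - c) 0) - max (c - X ω) 0 := by
    intro ω
    rcases le_total (X ω) c with h | h
    · rw [max_eq_right (by linarith), max_eq_left (by linarith)]; ring
    · rw [max_eq_left (by linarith), max_eq_right (by linarith)]; ring
  have h3 : Integrable (fun ω => c + max (X ω - c) 0) := (integrable_const c).add h1
  calc ∫ ω, X ω = ∫ ω, ((c + max (X ω - c) 0) - max (c - X ω) 0) := by
        congr 1; funext ω; exact e ω
    _ = _ := by
        rw [integral_sub h3 h2, integral_add (integrable_const c) h1]
        simp

lemma gg_tail_int {X : Ω → ℝ} (hXm : Measurable X) (hX : Integrable X) (c : ℝ)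
    {t : ℝ} (ht : 0 < t) (ht1 : t < 1) :
    IntegrableOn (fun x => gg t (tailCDF X x)) (Ioi c) ∧
    IntegrableOn (fun x => gg t (tailCDF X x)) (Iic c) := by
  have hm : Measurable (fun x => gg t (tailCDF X x)) :=
    gg_measurable.comp (measurable_const.prodMk (tail_measurable X))
  constructor
  · refine Integrable.mono' (g := fun x => tailCDF X x / t - tailCDF X x) ?_ hm.aestronglyMeasurable ?_
    · exact ((pos_part hX c).1.div_const t).sub (pos_part hX c).1
    · filter_upwards with x
      rw [Real.norm_eq_abs, abs_of_nonneg (gg_nonneg ht ht1 (tail_nonneg X x) (tail_le_one X x))]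
      exact gg_le_div _ _
  · refine Integrable.mono' (neg_part hXm hX c).1 hm.aestronglyMeasurable ?_
    filter_upwards with x
    rw [Real.norm_eq_abs, abs_of_nonneg (gg_nonneg ht ht1 (tail_nonneg X x) (tail_le_one X x))]
    exact gg_le_one_sub _ _

lemma cv_split {X : Ω → ℝ} (hXm : Measurable X) (hX : Integrable X) (c : ℝ)
    {t : ℝ} (ht : 0 < t) (ht1 : t < 1) :
    cv X t = c + (∫ x in Ioi c, tailCDF X x) - (∫ x in Iic c, (1 - tailCDF X x)) +
      ((∫ x in Iic c, gg t (tailCDF X x)) + ∫ x in Ioi c, gg t (tailCDF X x)) := by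
  obtain ⟨h1, h2⟩ := gg_tail_int hXm hX c ht ht1
  rw [cv, mean_decomp hXm hX c, intervalIntegral.integral_Iic_add_Ioi h2 h1]

lemma int_div_sub {X : Ω → ℝ} (hX : Integrable X) (c t : ℝ) :
    ∫ x in Ioi c, (tailCDF X x / t - tailCDF X x)
      = (∫ x in Ioi c, tailCDF X x) / t - ∫ x in Ioi c, tailCDF X x := by
  rw [integral_sub ((pos_part hX c).1.div_const t) (pos_part hX c).1, integral_div]

lemma cv_le {X : Ω → ℝ} (hXm : Measurable X) (hX : Integrable X) (c : ℝ)
    {t : ℝ} (ht : 0 < t) (ht1 : t < 1) :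
    cv X t ≤ c + (∫ x in Ioi c, tailCDF X x) / t := by
  obtain ⟨h1, h2⟩ := gg_tail_int hXm hX c ht ht1
  have a1 : ∫ x in Ioi c, gg t (tailCDF X x) ≤ ∫ x in Ioi c, (tailCDF X x / t - tailCDF X x) :=
    integral_mono h1 (((pos_part hX c).1.div_const t).sub (pos_part hX c).1) (fun x => gg_le_div _ _)
  have a2 : ∫ x in Iic c, gg t (tailCDF X x) ≤ ∫ x in Iic c, (1 - tailCDF X x) :=
    integral_mono h2 (neg_part hXm hX c).1 (fun x => gg_le_one_sub _ _)
  rw [int_div_sub hX] at a1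
  rw [cv_split hXm hX c ht ht1]
  linarith

lemma cv_exists {X : Ω → ℝ} (hXm : Measurable X) (hX : Integrable X)
    {t : ℝ} (ht : 0 < t) (ht1 : t < 1) :
    ∃ c, cv X t = c + (∫ x in Ioi c, tailCDF X x) / t := by
  obtain ⟨c, hc1, hc2⟩ := quantile hXm ht ht1
  refine ⟨c, ?_⟩
  have a1 : ∫ x in Ioi c, gg t (tailCDF X x) = ∫ x in Ioi c, (tailCDF X x / t - tailCDF X x) := by
    apply setIntegral_congr_fun measurableSet_Ioi
    intro x hx
    simp only [gg]
    rw [min_eq_left (by rw [div_le_iff₀ ht]; linarith [hc1 x hx])]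
  have a2 : ∫ x in Iic c, gg t (tailCDF X x) = ∫ x in Iic c, (1 - tailCDF X x) := by
    rw [integral_Iic_eq_integral_Iio, integral_Iic_eq_integral_Iio]
    apply setIntegral_congr_fun measurableSet_Iio
    intro x hx
    simp only [gg]
    rw [min_eq_right (by rw [le_div_iff₀ ht]; linarith [hc2 x hx])]
  rw [int_div_sub hX] at a1
  rw [cv_split hXm hX c ht ht1]
  linarith

lemma cv_mono {X Y : Ω → ℝ} (hXm : Measurable X) (hX : Integrable X) (hYm : Measurable Y)
    (hY : Integrable Y) (h : ∀ x, tailCDF X x ≤ tailCDF Y x) {t : ℝ} (ht : 0 < t) (ht1 : t < 1) :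
    cv X t ≤ cv Y t := by
  obtain ⟨c, hc⟩ := cv_exists hYm hY ht ht1
  rw [hc]
  refine (cv_le hXm hX c ht ht1).trans ?_
  have := integral_mono (pos_part hX c).1 (pos_part hY c).1 h
  gcongr

lemma cv_subadd {X Y : Ω → ℝ} (hXm : Measurable X) (hX : Integrable X) (hYm : Measurable Y)
    (hY : Integrable Y) {t : ℝ} (ht : 0 < t) (ht1 : t < 1) :
    cv (fun ω => X ω + Y ω) t ≤ cv X t + cv Y t := by
  obtain ⟨c, hc⟩ := cv_exists hXm hX ht ht1
  obtain ⟨d, hd⟩ := cv_exists hYm hY ht ht1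
  have hS : Integrable (fun ω => X ω + Y ω) := hX.add hY
  refine (cv_le (X := fun ω => X ω + Y ω) (hXm.add hYm) hS (c + d) ht ht1).trans ?_
  rw [hc, hd, ← (pos_part hX c).2, ← (pos_part hY d).2, ← (pos_part hS (c + d)).2]
  have h1 : Integrable (fun ω => max (X ω - c) 0) := (hX.sub (integrable_const c)).pos_part
  have h2 : Integrable (fun ω => max (Y ω - d) 0) := (hY.sub (integrable_const d)).pos_part
  have h3 : Integrable (fun ω => max (X ω + Y ω - (c + d)) 0) :=
    (hS.sub (integrable_const (c + d))).pos_part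
  have key : ∫ ω, max (X ω + Y ω - (c + d)) 0 ≤ (∫ ω, max (X ω - c) 0) + ∫ ω, max (Y ω - d) 0 := by
    rw [← integral_add h1 h2]
    refine integral_mono h3 (h1.add h2) ?_
    intro ω
    have a1 := le_max_left (X ω - c) 0
    have a2 := le_max_left (Y ω - d) 0
    have a3 := le_max_right (X ω - c) 0
    have a4 := le_max_right (Y ω - d) 0
    exact max_le (by linarith) (by linarith)
  have := div_le_div_of_nonneg_right key ht.le
  rw [add_div] at this
  linarith

lemma cumRes_eq {Ω : Type*} [MeasureSpace Ω] (X : Ω → ℝ) (n : ℕ) :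
    cumResNat n X = ∫ x, dlt n (tailCDF X x) := by
  unfold cumResNat dlt
  split_ifs
  · rw [integral_neg]
  · rw [integral_const_mul]

lemma gg_prod_integrable (X : Ω → ℝ)
    (h : Integrable (fun x : ℝ => tailCDF X x * Real.log (tailCDF X x)) (volume : Measure ℝ)) :
    Integrable (fun p : ℝ × ℝ => gg p.1 (tailCDF X p.2))
      ((volume.restrict (Ioo (0:ℝ) 1)).prod (volume : Measure ℝ)) := by
  have hm : Measurable (fun p : ℝ × ℝ => gg p.1 (tailCDF X p.2)) :=
    gg_measurable.comp (measurable_fst.prodMk ((tail_measurable X).comp measurable_snd))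
  rw [integrable_prod_iff' hm.aestronglyMeasurable]
  constructor
  · filter_upwards with x
    exact gg_integrableOn (tail_nonneg X x) (tail_le_one X x)
  · have e : (fun x => ∫ t in Ioo (0:ℝ) 1, ‖gg t (tailCDF X x)‖)
        = fun x => -(tailCDF X x * Real.log (tailCDF X x)) := by
      funext x
      have h1 := gg_int (tail_nonneg X x) (tail_le_one X x) 0
      simp only [dlt, if_true, pow_zero, one_mul, Nat.cast_zero, zero_add] at h1
      rw [← h1]
      apply setIntegral_congr_fun measurableSet_Ioo
      intro t ht
      simp only
      rw [Real.norm_eq_abs, abs_of_nonneg (gg_nonneg ht.1 ht.2 (tail_nonneg X x) (tail_le_one X x))]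
    simp only
    rw [e]
    exact h.neg

lemma moment (X : Ω → ℝ)
    (h : Integrable (fun x : ℝ => tailCDF X x * Real.log (tailCDF X x)) (volume : Measure ℝ))
    (n : ℕ) :
    ((n:ℝ) + 1) * ∫ t in Ioo (0:ℝ) 1, t ^ n * ∫ x, gg t (tailCDF X x) = cumResNat n X := by
  have hI := gg_prod_integrable X h
  have hI2 : Integrable (Function.uncurry (fun t x : ℝ => t ^ n * gg t (tailCDF X x)))
      ((volume.restrict (Ioo (0:ℝ) 1)).prod (volume : Measure ℝ)) := by
    refine Integrable.bdd_mul (f := fun p : ℝ × ℝ => p.1 ^ n) (c := 1) hI (by fun_prop) ?_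
    have := (Measure.quasiMeasurePreserving_fst (μ := volume.restrict (Ioo (0:ℝ) 1))
      (ν := (volume : Measure ℝ))).ae (ae_restrict_mem measurableSet_Ioo)
    filter_upwards [this] with p hp
    rw [Real.norm_eq_abs, abs_of_nonneg (by have := hp.1; positivity)]
    exact pow_le_one₀ hp.1.le hp.2.le
  simp_rw [← integral_const_mul (_ ^ n)]
  rw [integral_integral_swap hI2, cumRes_eq, ← integral_const_mul]
  congr 1
  funext x
  exact gg_int (tail_nonneg X x) (tail_le_one X x) n

lemma dlt_nonneg {u : ℝ} (hu : 0 ≤ u) (hu1 : u ≤ 1) (n : ℕ) : 0 ≤ dlt n u := by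
  rw [← gg_int hu hu1 n]
  refine mul_nonneg (by positivity) (setIntegral_nonneg measurableSet_Ioo ?_)
  intro t ht
  have := gg_nonneg ht.1 ht.2 hu hu1
  have := ht.1
  positivity

lemma cumRes_le (X : Ω → ℝ)
    (h : Integrable (fun x : ℝ => tailCDF X x * Real.log (tailCDF X x)) (volume : Measure ℝ))
    (n : ℕ) : cumResNat n X ≤ cumResNat 0 X := by
  rw [cumRes_eq, cumRes_eq]
  apply integral_mono_of_nonneg
  · filter_upwards with x using dlt_nonneg (tail_nonneg X x) (tail_le_one X x) n
  · simpa [dlt] using h.neg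
  · filter_upwards with x using dlt_le (tail_nonneg X x) (tail_le_one X x) n

lemma nu_eq (s : ℝ) (hs : -1 < s) (X : Ω → ℝ)
    (h : Integrable (fun x : ℝ => tailCDF X x * Real.log (tailCDF X x)) (volume : Measure ℝ)) :
    IntegrableOn (fun t => (1 - t) ^ s * cv X t) (Ioo 0 1) ∧
    nuNabla s X = (1 + s) * ∫ t in Ioo (0:ℝ) 1, (1 - t) ^ s * cv X t := by
  have hG : IntegrableOn (fun t => ∫ x, gg t (tailCDF X x)) (Ioo 0 1) :=
    (gg_prod_integrable X h).integral_prod_left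
  obtain ⟨i1, s1⟩ := swap_general s hs _ hG (cumResNat 0 X) (by
    intro n
    refine le_trans (le_of_eq ?_) (cumRes_le X h n)
    rw [← moment X h n]
    congr 1
    apply setIntegral_congr_fun measurableSet_Ioo
    intro t ht
    simp only
    rw [abs_of_nonneg (integral_nonneg fun x =>
      gg_nonneg ht.1 ht.2 (tail_nonneg X x) (tail_le_one X x))])
  obtain ⟨i2, -⟩ := swap_general s hs (fun _ => 1) (by simp) 1 (by
    intro n
    simp only [abs_one, mul_one]
    exact (pow_int n).le)
  simp only [mul_one] at i2
  have e : (fun t => (1 - t) ^ s * cv X t) =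
      fun t => (1 - t) ^ s * (∫ ω, X ω) + (1 - t) ^ s * ∫ x, gg t (tailCDF X x) := by
    funext t; rw [cv, mul_add]
  have i3 : IntegrableOn (fun t => (1 - t) ^ s * (∫ ω, X ω)) (Ioo 0 1) := i2.mul_const _
  rw [e]
  refine ⟨i3.add i1, ?_⟩
  rw [integral_add i3 i1, integral_mul_const, one_sub_rpow_int s hs, mul_add]
  simp_rw [moment X h] at s1
  have h3 : 1 + s ≠ 0 := by linarith
  rw [nuNabla, nablaBar]
  simp_rw [coef_eq]
  rw [s1.tsum_eq]
  field_simp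

lemma nu_le_of_cv (s : ℝ) (hs : -1 < s) (f g : ℝ → ℝ)
    (hf : IntegrableOn (fun t => (1 - t) ^ s * f t) (Ioo 0 1))
    (hg : IntegrableOn (fun t => (1 - t) ^ s * g t) (Ioo 0 1))
    (hfg : ∀ t, 0 < t → t < 1 → f t ≤ g t) :
    (1 + s) * ∫ t in Ioo (0:ℝ) 1, (1 - t) ^ s * f t
      ≤ (1 + s) * ∫ t in Ioo (0:ℝ) 1, (1 - t) ^ s * g t := by
  have h3 : 0 ≤ 1 + s := by linarith
  refine mul_le_mul_of_nonneg_left (setIntegral_mono_on hf hg measurableSet_Ioo ?_) h3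
  intro t ht
  exact mul_le_mul_of_nonneg_left (hfg t ht.1 ht.2) (Real.rpow_nonneg (by linarith [ht.2]) s)

end tails

lemma tail_scale {Ω : Type*} [MeasureSpace Ω] (X : Ω → ℝ) {a : ℝ} (ha : 0 < a) (x : ℝ) :
    tailCDF (fun ω => a * X ω) x = tailCDF X (x / a) := by
  unfold tailCDF
  congr 2
  ext ω
  simp only [mem_ofPred_eq]
  rw [div_lt_iff₀ ha, mul_comm]

lemma tail_shift {Ω : Type*} [MeasureSpace Ω] (X : Ω → ℝ) (b x : ℝ) :
    tailCDF (fun ω => X ω + b) x = tailCDF X (x - b) := by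
  unfold tailCDF
  congr 2
  ext ω
  simp only [mem_ofPred_eq]
  rw [sub_lt_iff_lt_add]

lemma cumRes_scale {Ω : Type*} [MeasureSpace Ω] (X : Ω → ℝ) {a : ℝ} (ha : 0 < a) (n : ℕ) :
    cumResNat n (fun ω => a * X ω) = a * cumResNat n X := by
  rw [cumRes_eq, cumRes_eq]
  simp_rw [tail_scale X ha]
  rw [Measure.integral_comp_div (fun x => dlt n (tailCDF X x)), abs_of_pos ha, smul_eq_mul]

lemma cumRes_shift {Ω : Type*} [MeasureSpace Ω] (X : Ω → ℝ) (b : ℝ) (n : ℕ) :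
    cumResNat n (fun ω => X ω + b) = cumResNat n X := by
  rw [cumRes_eq, cumRes_eq]
  simp_rw [tail_shift X b]
  rw [integral_sub_right_eq_self (fun x => dlt n (tailCDF X x))]

/-- **Theorem Cohe for `ν_s^∇`.** For every `s > −1`, the functional
`ν_s^∇(X) = E[X] + ∇̄_s(X)` is a coherent risk measure on integrable random variables with
`Δ̄_0(X) < ∞`: it is monotone for the stochastic order, positively homogeneous, translation
invariant, and subadditive. -/
theorem nuNabla_coherent_risk_measure
    {Ω : Type*} [MeasureSpace Ω] [IsProbabilityMeasure (volume : Measure Ω)]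
    (s : ℝ) (hs : -1 < s) :
    (∀ X Y : Ω → ℝ, Measurable X → Measurable Y → Integrable X → Integrable Y →
      Integrable (fun x : ℝ => tailCDF X x * Real.log (tailCDF X x)) (volume : Measure ℝ) →
      Integrable (fun x : ℝ => tailCDF Y x * Real.log (tailCDF Y x)) (volume : Measure ℝ) →
      (∀ x, tailCDF X x ≤ tailCDF Y x) → nuNabla s X ≤ nuNabla s Y)
    ∧ (∀ X : Ω → ℝ, Measurable X → Integrable X →
        Integrable (fun x : ℝ => tailCDF X x * Real.log (tailCDF X x)) (volume : Measure ℝ) →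
        ∀ a : ℝ, 0 < a → nuNabla s (fun ω => a * X ω) = a * nuNabla s X)
    ∧ (∀ X : Ω → ℝ, Measurable X → Integrable X →
        Integrable (fun x : ℝ => tailCDF X x * Real.log (tailCDF X x)) (volume : Measure ℝ) →
        ∀ b : ℝ, nuNabla s (fun ω => X ω + b) = nuNabla s X + b)
    ∧ (∀ X Y : Ω → ℝ, Measurable X → Measurable Y → Integrable X → Integrable Y →
        Integrable (fun x : ℝ => tailCDF X x * Real.log (tailCDF X x)) (volume : Measure ℝ) →
        Integrable (fun x : ℝ => tailCDF Y x * Real.log (tailCDF Y x)) (volume : Measure ℝ) →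
        Integrable (fun x : ℝ => tailCDF (fun ω => X ω + Y ω) x
            * Real.log (tailCDF (fun ω => X ω + Y ω) x)) (volume : Measure ℝ) →
        nuNabla s (fun ω => X ω + Y ω) ≤ nuNabla s X + nuNabla s Y) := by
  refine ⟨?_, ?_, ?_, ?_⟩
  · intro X Y hXm hYm hX hY hlX hlY hle
    obtain ⟨iX, eX⟩ := nu_eq s hs X hlX
    obtain ⟨iY, eY⟩ := nu_eq s hs Y hlY
    rw [eX, eY]
    exact nu_le_of_cv s hs _ _ iX iY (fun t ht ht1 => cv_mono hXm hX hYm hY hle ht ht1)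
  · intro X _ _ _ a ha
    unfold nuNabla nablaBar
    rw [integral_const_mul]
    simp_rw [cumRes_scale X ha, mul_left_comm _ a, tsum_mul_left]
    ring
  · intro X _ hX _ b
    unfold nuNabla nablaBar
    simp_rw [cumRes_shift X b]
    rw [integral_add hX (integrable_const b)]
    simp
    ring
  · intro X Y hXm hYm hX hY hlX hlY hlS
    obtain ⟨iX, eX⟩ := nu_eq s hs X hlX
    obtain ⟨iY, eY⟩ := nu_eq s hs Y hlY
    obtain ⟨iS, eS⟩ := nu_eq s hs _ hlS
    rw [eX, eY, eS, ← mul_add, ← integral_add iX iY]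
    simp_rw [← mul_add]
    refine nu_le_of_cv s hs _ _ iS ?_ (fun t ht ht1 => cv_subadd hXm hX hYm hY ht ht1)
    simp_rw [mul_add]
    exact iX.add iY
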